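/- Algebraic characterization of crossing standardization lines: for a heptagon with vertices p_0, …, p_6 in clockwise convex position, the standardization line ℓ_i is +-crossing if and only if det(p̂_{i+2}, p̂_{i+1}, p_i^−) = [−1,−2,−3]_i·[2,1,0]_i − [−1,−2,0]_i·[2,1,−3]_i ≥ 0, and ℓ_i is −-crossing if and only if det(p̂_{i−2}, p̂_{i−1}, p_i^+) = [1,2,3]_i·[−2,−1,0]_i − [1,2,0]_i·[−2,−1,3]_i ≥ 0. -/

import Mathlib

open Matrix

/-- Homogeneous coordinates of a point in the plane. -/
noncomputable def hat (p : Fin 2 → ℝ) : Fin 3 → ℝ := ![p 0, p 1, 1]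

/-- Determinant of the 3×3 matrix with rows `u`, `v`, `w`. -/
def det3 (u v w : Fin 3 → ℝ) : ℝ := Matrix.det (Matrix.of ![u, v, w])

/-- The standardization point `p_i⁺`. -/
noncomputable def pplus (p : Fin 7 → Fin 2 → ℝ) (i : Fin 7) : Fin 3 → ℝ :=
  crossProduct (crossProduct (hat (p (i + 1))) (hat (p (i + 2))))
    (crossProduct (hat (p i)) (hat (p (i + 3))))

/-- The standardization point `p_i⁻`. -/
noncomputable def pminus (p : Fin 7 → Fin 2 → ℝ) (i : Fin 7) : Fin 3 → ℝ :=
  crossProduct (crossProduct (hat (p (i - 1))) (hat (p (i - 2))))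
    (crossProduct (hat (p i)) (hat (p (i - 3))))

/-- The `i`-th standardization line `ℓ_i` (in homogeneous line coordinates). -/
noncomputable def sline (p : Fin 7 → Fin 2 → ℝ) (i : Fin 7) : Fin 3 → ℝ :=
  crossProduct (pplus p i) (pminus p i)

/-- The line `ℓ_i` is `+`-crossing: it separates `p_{i+1}` and `p_{i+2}` from the
remaining vertices of the heptagon. -/
noncomputable def IsPlusCrossing (p : Fin 7 → Fin 2 → ℝ) (i : Fin 7) : Prop :=
  ∃ ε : ℝ, (ε = 1 ∨ ε = -1) ∧
    0 ≤ ε * (sline p i ⬝ᵥ hat (p (i + 1))) ∧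
    0 ≤ ε * (sline p i ⬝ᵥ hat (p (i + 2))) ∧
    ∀ j : Fin 7, j ≠ i + 1 → j ≠ i + 2 → ε * (sline p i ⬝ᵥ hat (p j)) < 0

/-- The line `ℓ_i` is `−`-crossing: it separates `p_{i−1}` and `p_{i−2}` from the
remaining vertices of the heptagon. -/
noncomputable def IsMinusCrossing (p : Fin 7 → Fin 2 → ℝ) (i : Fin 7) : Prop :=
  ∃ ε : ℝ, (ε = 1 ∨ ε = -1) ∧
    0 ≤ ε * (sline p i ⬝ᵥ hat (p (i - 1))) ∧
    0 ≤ ε * (sline p i ⬝ᵥ hat (p (i - 2))) ∧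
    ∀ j : Fin 7, j ≠ i - 1 → j ≠ i - 2 → ε * (sline p i ⬝ᵥ hat (p j)) < 0

/-- The bracket `[x, y, z]_i`, indices mod 7. -/
noncomputable def br (p : Fin 7 → Fin 2 → ℝ) (i x y z : Fin 7) : ℝ :=
  det3 (hat (p (i + x))) (hat (p (i + y))) (hat (p (i + z)))

lemma det3_apply (u v w : Fin 3 → ℝ) :
    det3 u v w = u 0 * v 1 * w 2 - u 0 * v 2 * w 1 - u 1 * v 0 * w 2 + u 1 * v 2 * w 0
      + u 2 * v 0 * w 1 - u 2 * v 1 * w 0 := by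
  simp [det3, Matrix.det_fin_three]

lemma det3_rotate (u v w : Fin 3 → ℝ) : det3 u v w = det3 v w u := by
  simp only [det3_apply]; ring

lemma det3_neg_reverse (u v w : Fin 3 → ℝ) : det3 (-u) (-v) (-w) = det3 w v u := by
  simp only [det3_apply, Pi.neg_apply]; ring

lemma crossProduct_dotProduct (u v w : Fin 3 → ℝ) : crossProduct u v ⬝ᵥ w = det3 u v w := by
  simp [det3_apply, cross_apply, dotProduct, Fin.sum_univ_three]; ring

/-- The intersection of the lines `uv` and `wx`, as a combination of `w` and `x`. -/
lemma cross_cross_eq_right (u v w x : Fin 3 → ℝ) :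
    crossProduct (crossProduct u v) (crossProduct w x) =
      det3 u v x • w - det3 u v w • x := by
  ext k
  fin_cases k <;> simp [det3_apply, cross_apply] <;> ring

/-- The intersection of the lines `uv` and `wx`, as a combination of `u` and `v`. -/
lemma cross_cross_eq_left (u v w x : Fin 3 → ℝ) :
    crossProduct (crossProduct u v) (crossProduct w x) =
      det3 u w x • v - det3 v w x • u := by
  ext k
  fin_cases k <;> simp [det3_apply, cross_apply] <;> ring

/-- The linear relation among four vectors of `ℝ³` (Cramer's rule), under a linear form. -/
lemma dotProduct_cramer (f a b c d : Fin 3 → ℝ) :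
    det3 b c d * (f ⬝ᵥ a) - det3 a c d * (f ⬝ᵥ b) + det3 a b d * (f ⬝ᵥ c)
      - det3 a b c * (f ⬝ᵥ d) = 0 := by
  simp only [det3_apply, dotProduct, Fin.sum_univ_three]; ring

lemma det3_cross_cross (a b u v w x : Fin 3 → ℝ) :
    det3 a b (crossProduct (crossProduct u v) (crossProduct w x)) =
      det3 u v x * det3 a b w - det3 u v w * det3 a b x := by
  rw [cross_cross_eq_right]
  simp only [det3_apply, Pi.sub_apply, Pi.smul_apply, smul_eq_mul]; ring

/-- The vectors `v 0, …, v 6` are in clockwise convex position up to positive scaling. -/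
def IsClockwise (v : Fin 7 → Fin 3 → ℝ) : Prop :=
  ∀ i j k : Fin 7, i < j → j < k → det3 (v i) (v j) (v k) < 0

lemma IsClockwise.rotate {v : Fin 7 → Fin 3 → ℝ} (hv : IsClockwise v) (i : Fin 7) :
    IsClockwise fun j ↦ v (i + j) := by
  intro j k l hjk hkl
  have key : ∀ i j k l : Fin 7, j < k → k < l →
      (i + j < i + k ∧ i + k < i + l) ∨ (i + k < i + l ∧ i + l < i + j) ∨
        (i + l < i + j ∧ i + j < i + k) := by
    intro i j k l; lia
  rcases key i j k l hjk hkl with ⟨h, h'⟩ | ⟨h, h'⟩ | ⟨h, h'⟩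
  · exact hv _ _ _ h h'
  · rw [det3_rotate]; exact hv _ _ _ h h'
  · rw [← det3_rotate]; exact hv _ _ _ h h'

lemma IsClockwise.reflect {v : Fin 7 → Fin 3 → ℝ} (hv : IsClockwise v) :
    IsClockwise fun j ↦ -v (-j) := by
  intro j k l hjk hkl
  have key : ∀ j k l : Fin 7, j < k → k < l →
      (-l < -k ∧ -k < -j) ∨ (-j < -l ∧ -l < -k) := by
    decide
  rw [det3_neg_reverse]
  rcases key j k l hjk hkl with ⟨h, h'⟩ | ⟨h, h'⟩
  · exact hv _ _ _ h h'
  · rw [← det3_rotate]; exact hv _ _ _ h h'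

lemma IsClockwise.crossing_iff {v : Fin 7 → Fin 3 → ℝ} (hv : IsClockwise v)
    {P M : Fin 3 → ℝ}
    (hP : P = crossProduct (crossProduct (v 1) (v 2)) (crossProduct (v 0) (v 3)))
    (hM : M = crossProduct (crossProduct (v 6) (v 5)) (crossProduct (v 0) (v 4))) :
    (∃ ε : ℝ, (ε = 1 ∨ ε = -1) ∧ 0 ≤ ε * (crossProduct P M ⬝ᵥ v 1) ∧
      0 ≤ ε * (crossProduct P M ⬝ᵥ v 2) ∧
      ∀ j : Fin 7, j ≠ 1 → j ≠ 2 → ε * (crossProduct P M ⬝ᵥ v j) < 0) ↔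
    0 ≤ det3 (v 2) (v 1) M := by
  have h012 := hv 0 1 2 (by decide) (by decide)
  have h013 := hv 0 1 3 (by decide) (by decide)
  have h023 := hv 0 2 3 (by decide) (by decide)
  have h123 := hv 1 2 3 (by decide) (by decide)
  have h034 := hv 0 3 4 (by decide) (by decide)
  have h056 := hv 0 5 6 (by decide) (by decide)
  have h046 := hv 0 4 6 (by decide) (by decide)
  have h045 := hv 0 4 5 (by decide) (by decide)
  have h456 := hv 4 5 6 (by decide) (by decide)
  have h235 := hv 2 3 5 (by decide) (by decide)
  have h035 := hv 0 3 5 (by decide) (by decide)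
  have h025 := hv 0 2 5 (by decide) (by decide)
  have hP0 : P = det3 (v 1) (v 2) (v 3) • v 0 - det3 (v 0) (v 1) (v 2) • v 3 := by
    rw [hP, cross_cross_eq_right, det3_rotate (v 0)]
  have hP1 : P = det3 (v 0) (v 2) (v 3) • v 1 - det3 (v 0) (v 1) (v 3) • v 2 := by
    rw [hP, cross_cross_eq_left]
    ext k; simp only [det3_apply, Pi.sub_apply, Pi.smul_apply, smul_eq_mul]; ring
  have hM0 : M = det3 (v 0) (v 5) (v 6) • v 4 - det3 (v 4) (v 5) (v 6) • v 0 := by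
    rw [hM, cross_cross_eq_right]
    ext k; simp only [det3_apply, Pi.sub_apply, Pi.smul_apply, smul_eq_mul]; ring
  have hM1 : M = det3 (v 0) (v 4) (v 6) • v 5 - det3 (v 0) (v 4) (v 5) • v 6 := by
    rw [hM, cross_cross_eq_left]
    ext k; simp only [det3_apply, Pi.sub_apply, Pi.smul_apply, smul_eq_mul]; ring
  have f0 : crossProduct P M ⬝ᵥ v 0 =
      -(det3 (v 0) (v 1) (v 2) * det3 (v 0) (v 5) (v 6) * det3 (v 0) (v 3) (v 4)) := by
    rw [crossProduct_dotProduct, hP0, hM0]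
    generalize det3 (v 1) (v 2) (v 3) = α
    generalize det3 (v 0) (v 1) (v 2) = β
    generalize det3 (v 4) (v 5) (v 6) = γ
    generalize det3 (v 0) (v 5) (v 6) = δ
    simp only [det3_apply, Pi.sub_apply, Pi.smul_apply, smul_eq_mul]; ring
  have f1 : crossProduct P M ⬝ᵥ v 1 = det3 (v 0) (v 1) (v 3) * det3 (v 2) (v 1) M := by
    rw [crossProduct_dotProduct, hP1]
    generalize det3 (v 0) (v 1) (v 3) = α
    generalize det3 (v 0) (v 2) (v 3) = β
    simp only [det3_apply, Pi.sub_apply, Pi.smul_apply, smul_eq_mul]; ring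
  have f2 : crossProduct P M ⬝ᵥ v 2 = det3 (v 0) (v 2) (v 3) * det3 (v 2) (v 1) M := by
    rw [crossProduct_dotProduct, hP1]
    generalize det3 (v 0) (v 1) (v 3) = α
    generalize det3 (v 0) (v 2) (v 3) = β
    simp only [det3_apply, Pi.sub_apply, Pi.smul_apply, smul_eq_mul]; ring
  have fP : crossProduct P M ⬝ᵥ P = 0 := by rw [dotProduct_comm, dot_self_cross]
  have fM : crossProduct P M ⬝ᵥ M = 0 := by rw [dotProduct_comm, dot_cross_self]
  have cram := dotProduct_cramer (crossProduct P M) (v 0) (v 2) (v 3) (v 5)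
  generalize crossProduct P M = f at *
  have f3 : det3 (v 1) (v 2) (v 3) * (f ⬝ᵥ v 0) = det3 (v 0) (v 1) (v 2) * (f ⬝ᵥ v 3) := by
    rw [hP0] at fP
    simpa [dotProduct_sub, sub_eq_zero] using fP
  have f4 : det3 (v 0) (v 5) (v 6) * (f ⬝ᵥ v 4) = det3 (v 4) (v 5) (v 6) * (f ⬝ᵥ v 0) := by
    rw [hM0] at fM
    simpa [dotProduct_sub, sub_eq_zero] using fM
  have f56 : det3 (v 0) (v 4) (v 6) * (f ⬝ᵥ v 5) = det3 (v 0) (v 4) (v 5) * (f ⬝ᵥ v 6) := by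
    rw [hM1] at fM
    simpa [dotProduct_sub, sub_eq_zero] using fM
  have f0pos : 0 < f ⬝ᵥ v 0 := by
    rw [f0, neg_pos]
    exact mul_neg_of_pos_of_neg (mul_pos_of_neg_of_neg h012 h056) h034
  have f3pos : 0 < f ⬝ᵥ v 3 := by
    have := mul_neg_of_neg_of_pos h123 f0pos
    rw [f3] at this
    exact pos_of_mul_neg_right this h012.le
  have f4pos : 0 < f ⬝ᵥ v 4 := by
    have := mul_neg_of_neg_of_pos h456 f0pos
    rw [← f4] at this
    exact pos_of_mul_neg_right this h056.le
  constructor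
  · rintro ⟨ε, rfl | rfl, h1, -, h⟩
    · have := h 0 (by decide) (by decide)
      linarith
    · rw [f1] at h1
      by_contra! hD
      have := mul_pos_of_neg_of_neg h013 hD
      linarith
  · intro hD
    have f2nonpos : f ⬝ᵥ v 2 ≤ 0 := f2 ▸ mul_nonpos_of_nonpos_of_nonneg h023.le hD
    have f1nonpos : f ⬝ᵥ v 1 ≤ 0 := f1 ▸ mul_nonpos_of_nonpos_of_nonneg h013.le hD
    have f5pos : 0 < f ⬝ᵥ v 5 := by
      by_contra! h5
      have := mul_neg_of_neg_of_pos h235 f0pos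
      have := mul_nonneg_of_nonpos_of_nonpos h035.le f2nonpos
      have := mul_neg_of_neg_of_pos h025 f3pos
      have := mul_nonneg_of_nonpos_of_nonpos h023.le h5
      linarith
    have f6pos : 0 < f ⬝ᵥ v 6 := by
      have := mul_neg_of_neg_of_pos h046 f5pos
      rw [f56] at this
      exact pos_of_mul_neg_right this h045.le
    refine ⟨-1, Or.inr rfl, by linarith, by linarith, fun j h1 h2 ↦ ?_⟩
    fin_cases j
    · simpa using f0pos
    · exact absurd rfl h1
    · exact absurd rfl h2
    · simpa using f3pos
    · simpa using f4pos
    · simpa using f5pos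
    · simpa using f6pos

lemma isPlusCrossing_iff {p : Fin 7 → Fin 2 → ℝ} (hp : IsClockwise fun j ↦ hat (p j))
    (i : Fin 7) :
    IsPlusCrossing p i ↔ 0 ≤ det3 (hat (p (i + 2))) (hat (p (i + 1))) (pminus p i) := by
  rw [← (hp.rotate i).crossing_iff (P := pplus p i) (M := pminus p i)]
  · refine exists_congr fun ε ↦ and_congr_right' <| and_congr_right' <| and_congr_right' ?_
    rw [← (Equiv.addLeft i).forall_congr_right]
    simp [sline]
  · simp [pplus]
  · rw [pminus, show i - 1 = i + 6 by lia, show i - 2 = i + 5 by lia,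
      show i - 3 = i + 4 by lia, add_zero]

lemma isMinusCrossing_iff {p : Fin 7 → Fin 2 → ℝ} (hp : IsClockwise fun j ↦ hat (p j))
    (i : Fin 7) :
    IsMinusCrossing p i ↔ 0 ≤ det3 (hat (p (i - 2))) (hat (p (i - 1))) (pplus p i) := by
  have hdet : det3 (hat (p (i - 2))) (hat (p (i - 1))) (pplus p i) =
      det3 (-hat (p (i + -2))) (-hat (p (i + -1))) (pplus p i) := by
    simp only [det3_apply, Pi.neg_apply, ← sub_eq_add_neg]; ring
  rw [hdet, ← ((hp.rotate i).reflect).crossing_iff (P := pminus p i) (M := pplus p i)]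
  · refine exists_congr fun ε ↦ ?_
    rw [← (Equiv.subLeft i).forall_congr_right]
    have hs : crossProduct (pminus p i) (pplus p i) = -sline p i := by
      rw [sline, cross_anticomm]
    simp [hs, ← sub_eq_add_neg]
  · simp [pminus, ← sub_eq_add_neg]
  · rw [pplus, show i + 1 = i + -6 by lia, show i + 2 = i + -5 by lia,
      show i + 3 = i + -4 by lia]
    simp

/-- Algebraic characterization of crossing standardization lines:
`ℓ_i` is `+`-crossing iff `det(p̂_{i+2}, p̂_{i+1}, p_i⁻) = AᵢBᵢ − CᵢDᵢ ≥ 0`, and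
`ℓ_i` is `−`-crossing iff `det(p̂_{i−2}, p̂_{i−1}, p_i⁺) = [1,2,3]ᵢ[−2,−1,0]ᵢ −
[1,2,0]ᵢ[−2,−1,3]ᵢ ≥ 0`. -/
theorem crossing_algebraic_characterization
    (p : Fin 7 → Fin 2 → ℝ)
    (hconv : ∀ i j k : Fin 7, i < j → j < k →
      det3 (hat (p i)) (hat (p j)) (hat (p k)) < 0) (i : Fin 7) :
    (det3 (hat (p (i + 2))) (hat (p (i + 1))) (pminus p i) =
        br p i (-1) (-2) (-3) * br p i 2 1 0 - br p i (-1) (-2) 0 * br p i 2 1 (-3)) ∧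
    (IsPlusCrossing p i ↔ 0 ≤ det3 (hat (p (i + 2))) (hat (p (i + 1))) (pminus p i)) ∧
    (det3 (hat (p (i - 2))) (hat (p (i - 1))) (pplus p i) =
        br p i 1 2 3 * br p i (-2) (-1) 0 - br p i 1 2 0 * br p i (-2) (-1) 3) ∧
    (IsMinusCrossing p i ↔ 0 ≤ det3 (hat (p (i - 2))) (hat (p (i - 1))) (pplus p i)) := by
  refine ⟨?_, isPlusCrossing_iff hconv i, ?_, isMinusCrossing_iff hconv i⟩
  · simp only [pminus, br, det3_cross_cross, sub_eq_add_neg, add_zero]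
  · simp only [pplus, br, det3_cross_cross, sub_eq_add_neg, add_zero]
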